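/- arXiv:1701.07890 — 3 statements merged into one kernel-verified Lean document; each statement's English description precedes it below -/
import Mathlib

section
/- For all complex z with |Im z| < 1/2 and |Re z| < 1/2, the identity 1/(4π) + Σ_{n=1}^∞ (-1)^n n cos(2nπz)/sinh(nπ) = -1/(4π) - Σ_{n=1}^∞ (-1)^n n cosh(2nπz)/sinh(nπ) holds. -/
open scoped Real
open MeasureTheory Set Filter Topology FourierTransform Complex

/-- The continuous extension of `x ↦ x / sinh (π x)` to the real line. -/
noncomputable def xDivSinh (x : ℝ) : ℝ := (dslope (fun t ↦ Real.sinh (π * t)) 0 x)⁻¹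

lemma hasDerivAt_sinh_pi_mul_zero : HasDerivAt (fun t ↦ Real.sinh (π * t)) π 0 := by
  simpa using ((hasDerivAt_id (0 : ℝ)).const_mul π).sinh

lemma xDivSinh_zero : xDivSinh 0 = π⁻¹ := by
  rw [xDivSinh, dslope_same, hasDerivAt_sinh_pi_mul_zero.deriv]

lemma xDivSinh_of_ne_zero {x : ℝ} (hx : x ≠ 0) : xDivSinh x = x / Real.sinh (π * x) := by
  simp [xDivSinh, dslope_of_ne _ hx, slope_def_field]

lemma xDivSinh_neg (x : ℝ) : xDivSinh (-x) = xDivSinh x := by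
  rcases eq_or_ne x 0 with rfl | hx
  · simp
  · rw [xDivSinh_of_ne_zero hx, xDivSinh_of_ne_zero (neg_ne_zero.mpr hx), mul_neg, Real.sinh_neg,
      neg_div_neg_eq]

lemma continuous_xDivSinh : Continuous xDivSinh := by
  refine Continuous.inv₀ ?_ fun x ↦ ?_
  · rw [← continuousOn_univ, continuousOn_dslope univ_mem]
    exact ⟨by fun_prop, hasDerivAt_sinh_pi_mul_zero.differentiableAt⟩
  · rcases eq_or_ne x 0 with rfl | hx
    · rw [dslope_same, hasDerivAt_sinh_pi_mul_zero.deriv]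
      exact Real.pi_ne_zero
    · simp [dslope_of_ne _ hx, slope_def_field, hx, Real.pi_ne_zero]

lemma xDivSinh_nonneg (x : ℝ) : 0 ≤ xDivSinh x := by
  wlog hx : 0 ≤ x
  · rw [← xDivSinh_neg]
    exact this _ (by linarith)
  rcases hx.eq_or_lt with rfl | hx
  · rw [xDivSinh_zero]
    positivity
  · rw [xDivSinh_of_ne_zero hx.ne']
    exact div_nonneg hx.le (Real.sinh_nonneg_iff.mpr (by positivity))

lemma xDivSinh_le (x : ℝ) : xDivSinh x ≤ (1 + 2 * π * |x|) * Real.exp (-(π * |x|)) := by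
  wlog hx : 0 ≤ x
  · rw [← xDivSinh_neg, ← abs_neg]
    exact this _ (by linarith)
  rw [abs_of_nonneg hx]
  rcases hx.eq_or_lt with rfl | hx
  · rw [xDivSinh_zero]
    simpa using inv_le_one_of_one_le₀ (by linarith [Real.pi_gt_three])
  · have hpos : 0 < Real.sinh (π * x) := Real.sinh_pos_iff.mpr (by positivity)
    rw [xDivSinh_of_ne_zero hx.ne', div_le_iff₀ hpos, Real.sinh_eq]
    have h1 := Real.add_one_le_exp (2 * (π * x))
    have h2 : Real.exp (-(π * x)) * Real.exp (π * x) = 1 := by rw [← Real.exp_add]; simp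
    have h3 : Real.exp (2 * (π * x)) * (Real.exp (-(π * x)) * Real.exp (-(π * x))) = 1 := by
      rw [← Real.exp_add, ← Real.exp_add, ← Real.exp_zero]; ring_nf
    have hE : 0 < Real.exp (-(π * x)) * Real.exp (-(π * x)) := by positivity
    have h4 : (1 + 2 * π * x) * (Real.exp (-(π * x)) * Real.exp (-(π * x))) ≤ 1 := by
      nlinarith
    have h5 : x ≤ π * x := by nlinarith [Real.pi_gt_three]
    nlinarith

/-- The kernel `x / sinh (π x) * exp (a x)`. -/
noncomputable def sinhKernel (a : ℂ) (x : ℝ) : ℂ := xDivSinh x * cexp (a * x)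

lemma continuous_sinhKernel (a : ℂ) : Continuous (sinhKernel a) :=
  (continuous_ofReal.comp continuous_xDivSinh).mul (by fun_prop)

lemma sinhKernel_neg (a : ℂ) (x : ℝ) : sinhKernel a (-x) = sinhKernel (-a) x := by
  simp [sinhKernel, xDivSinh_neg]

lemma exists_norm_sinhKernel_le {a : ℂ} (ha : |a.re| < π) :
    ∃ C, ∀ x, ‖sinhKernel a x‖ ≤ C * (1 + ‖x‖) ^ (-2 : ℝ) := by
  obtain ⟨d, hd, had⟩ : ∃ d, 0 < d ∧ |a.re| + 3 * d = π := ⟨(π - |a.re|) / 3, by linarith, by ring⟩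
  refine ⟨2 * π * (1 + d⁻¹) ^ 3, fun x ↦ ?_⟩
  have hpi := Real.pi_gt_three
  have ht := abs_nonneg x
  have hnorm : ‖sinhKernel a x‖ = xDivSinh x * Real.exp (a.re * x) := by
    simp [sinhKernel, norm_exp, abs_of_nonneg (xDivSinh_nonneg x)]
  have h1 : Real.exp (a.re * x) ≤ Real.exp (|a.re| * |x|) := by
    rw [← abs_mul]
    exact Real.exp_le_exp.mpr (le_abs_self _)
  have h2 : 1 + |x| ≤ (1 + d⁻¹) * Real.exp (d * |x|) := by
    have h := Real.add_one_le_exp (d * |x|)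
    have : d⁻¹ * (d * |x|) = |x| := by field_simp
    have hd' : 0 < d⁻¹ := by positivity
    nlinarith [mul_nonneg hd.le ht]
  have h3 : (1 + |x|) ^ 3 ≤ (1 + d⁻¹) ^ 3 * Real.exp (d * |x|) ^ 3 := by
    rw [← mul_pow]
    gcongr
  rw [Real.rpow_neg (by positivity), Real.rpow_ofNat, Real.norm_eq_abs, ← div_eq_mul_inv,
    le_div_iff₀ (by positivity), hnorm]
  calc xDivSinh x * Real.exp (a.re * x) * (1 + |x|) ^ 2
      ≤ ((1 + 2 * π * |x|) * Real.exp (-(π * |x|))) * Real.exp (|a.re| * |x|) * (1 + |x|) ^ 2 := by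
        gcongr
        exact xDivSinh_le x
    _ ≤ (2 * π * (1 + |x|) * Real.exp (-(π * |x|))) * Real.exp (|a.re| * |x|) * (1 + |x|) ^ 2 := by
        gcongr
        nlinarith
    _ = 2 * π * (Real.exp (-(π * |x|)) * Real.exp (|a.re| * |x|)) * (1 + |x|) ^ 3 := by ring
    _ ≤ 2 * π * (Real.exp (-(π * |x|)) * Real.exp (|a.re| * |x|)) *
          ((1 + d⁻¹) ^ 3 * Real.exp (d * |x|) ^ 3) := by gcongr
    _ = 2 * π * (1 + d⁻¹) ^ 3 *
          (Real.exp (-(π * |x|)) * Real.exp (|a.re| * |x|) * Real.exp (d * |x|) ^ 3) := by ring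
    _ = 2 * π * (1 + d⁻¹) ^ 3 := by
        have : -(π * |x|) + |a.re| * |x| + (3 : ℕ) * (d * |x|) = 0 := by
          push_cast
          linear_combination |x| * had
        rw [← Real.exp_nat_mul, ← Real.exp_add, ← Real.exp_add, this, Real.exp_zero, mul_one]

lemma integrable_sinhKernel {a : ℂ} (ha : |a.re| < π) : Integrable (sinhKernel a) := by
  obtain ⟨C, hC⟩ := exists_norm_sinhKernel_le ha
  exact ((integrable_one_add_norm (by simp)).const_mul C).mono'
    (continuous_sinhKernel a).aestronglyMeasurable (.of_forall hC)

lemma isBigO_sinhKernel {a : ℂ} (ha : |a.re| < π) :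
    sinhKernel a =O[cocompact ℝ] fun x ↦ |x| ^ (-2 : ℝ) := by
  obtain ⟨C, hC⟩ := exists_norm_sinhKernel_le ha
  have hC0 : 0 ≤ C := by simpa using (norm_nonneg _).trans (hC 0)
  refine .of_bound C ?_
  filter_upwards [(isCompact_singleton (x := (0 : ℝ))).compl_mem_cocompact] with x hx
  have hx : 0 < |x| := abs_pos.mpr hx
  rw [Real.norm_of_nonneg (Real.rpow_nonneg hx.le _)]
  refine (hC x).trans (mul_le_mul_of_nonneg_left ?_ hC0)
  exact Real.rpow_le_rpow_of_nonpos hx (by simp) (by norm_num)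

lemma integrableOn_mul_exp_neg_mul {r : ℝ} (hr : 0 < r) :
    IntegrableOn (fun x ↦ x * Real.exp (-(r * x))) (Ioi 0) := by
  have h := Real.integral_rpow_mul_exp_neg_mul_Ioi two_pos hr
  norm_num at h
  exact .of_integral_ne_zero (by rw [h]; positivity)

lemma integral_mul_exp_neg_mul {r : ℝ} (hr : 0 < r) :
    ∫ x in Ioi (0 : ℝ), x * Real.exp (-(r * x)) = (r ^ 2)⁻¹ := by
  have h := Real.integral_rpow_mul_exp_neg_mul_Ioi two_pos hr
  norm_num at h
  simpa using h

lemma norm_mul_cexp_neg_mul (c : ℂ) {x : ℝ} (hx : 0 ≤ x) :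
    ‖(x : ℂ) * cexp (-(c * x))‖ = x * Real.exp (-(c.re * x)) := by
  simp [norm_exp, abs_of_nonneg hx]

lemma integrableOn_mul_cexp_neg_mul {c : ℂ} (hc : 0 < c.re) :
    IntegrableOn (fun x : ℝ ↦ (x : ℂ) * cexp (-(c * x))) (Ioi 0) := by
  refine (integrableOn_mul_exp_neg_mul hc).mono' (by fun_prop) ?_
  filter_upwards [ae_restrict_mem measurableSet_Ioi] with x hx
  exact (norm_mul_cexp_neg_mul c (le_of_lt hx)).le

lemma integral_mul_cexp_neg_mul {c : ℂ} (hc : 0 < c.re) :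
    ∫ x : ℝ in Ioi 0, (x : ℂ) * cexp (-(c * x)) = 1 / c ^ 2 := by
  have hc0 : c ≠ 0 := by rintro rfl; simp at hc
  have hderiv (x : ℝ) : HasDerivAt (fun x : ℝ ↦ -(x / c + 1 / c ^ 2) * cexp (-(c * x)))
      (x * cexp (-(c * x))) x := by
    have h1 : HasDerivAt (fun w : ℂ ↦ -(w / c + 1 / c ^ 2) * cexp (-(c * w)))
        (x * cexp (-(c * x))) x := by
      convert! (((hasDerivAt_id (x : ℂ)).div_const c).add_const (1 / c ^ 2)).neg.mul
        ((hasDerivAt_id (x : ℂ)).const_mul c).neg.cexp using 1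
      simp
      field_simp
      ring
    exact h1.comp_ofReal
  have hlim (k : ℕ) : Tendsto (fun x : ℝ ↦ (x : ℂ) ^ k * cexp (-(c * x))) atTop (𝓝 0) := by
    rw [tendsto_zero_iff_norm_tendsto_zero]
    have h := isLittleO_pow_exp_pos_mul_atTop k hc
    refine h.tendsto_div_nhds_zero.congr' ?_
    filter_upwards [eventually_ge_atTop 0] with x hx
    simp [norm_exp, abs_of_nonneg hx, Real.exp_neg, div_eq_mul_inv]
  have hF : Tendsto (fun x : ℝ ↦ -(x / c + 1 / c ^ 2) * cexp (-(c * x))) atTop (𝓝 0) := by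
    have := ((hlim 1).const_mul (-(1 / c))).add ((hlim 0).const_mul (-(1 / c ^ 2)))
    simp only [mul_zero, add_zero] at this
    refine this.congr fun x ↦ ?_
    ring
  rw [integral_Ioi_of_hasDerivAt_of_tendsto (hderiv 0).continuousAt.continuousWithinAt
    (fun x _ ↦ hderiv x) (integrableOn_mul_cexp_neg_mul hc) hF]
  simp

lemma hasSum_exp_div_sinh {x : ℝ} (hx : 0 < x) :
    HasSum (fun k : ℕ ↦ 2 * Real.exp (-((2 * k + 1) * π * x))) (Real.sinh (π * x))⁻¹ := by
  have hlt : Real.exp (-(2 * π * x)) < 1 := Real.exp_lt_one_iff.mpr (by simp; positivity)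
  have h := (hasSum_geometric_of_lt_one (Real.exp_pos _).le hlt).mul_left
    (2 * Real.exp (-(π * x)))
  convert! h using 1
  · ext k
    rw [← Real.exp_nat_mul, mul_assoc 2, ← Real.exp_add]
    ring_nf
  · have h1 : Real.exp (-(2 * π * x)) = Real.exp (-(π * x)) * Real.exp (-(π * x)) := by
      rw [← Real.exp_add]; ring_nf
    have h2 : Real.exp (π * x) * Real.exp (-(π * x)) = 1 := by rw [← Real.exp_add]; simp
    have h3 : 0 < Real.sinh (π * x) := Real.sinh_pos_iff.mpr (by positivity)
    rw [inv_eq_iff_eq_inv, mul_inv_rev, inv_inv, eq_mul_inv_iff_mul_eq₀ (by positivity), h1,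
      Real.sinh_eq]
    linear_combination h2

lemma summable_inv_odd_pi_sub_sq {b : ℝ} (hb : b < π) :
    Summable fun k : ℕ ↦ (((2 * k + 1) * π - b) ^ 2)⁻¹ := by
  rw [← summable_nat_add_iff 1]
  refine .of_nonneg_of_le (fun k ↦ by positivity) (fun k ↦ ?_)
    ((summable_nat_add_iff 1).mpr (Real.summable_nat_pow_inv.mpr one_lt_two))
  have hpi := Real.pi_gt_three
  have hk : (0 : ℝ) ≤ k := k.cast_nonneg
  gcongr
  push_cast
  nlinarith

/-- Termwise integration of the kernel over the positive half-line. -/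
lemma hasSum_integral_Ioi_sinhKernel {a : ℂ} (ha : a.re < π) :
    HasSum (fun k : ℕ ↦ 2 / ((2 * k + 1) * π - a) ^ 2) (∫ x in Ioi 0, sinhKernel a x) := by
  let c (k : ℕ) : ℂ := (2 * k + 1) * π - a
  have hcre (k : ℕ) : (c k).re = (2 * k + 1) * π - a.re := by
    have : c k = ((2 * k + 1) * π : ℝ) - a := by simp [c]
    rw [this, sub_re, ofReal_re]
  have hc (k : ℕ) : 0 < (c k).re := by
    rw [hcre]
    nlinarith [Real.pi_pos, (k.cast_nonneg : (0 : ℝ) ≤ k)]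
  have h := hasSum_integral_of_summable_integral_norm (μ := volume.restrict (Ioi (0 : ℝ)))
    (F := fun (k : ℕ) (x : ℝ) ↦ 2 * ((x : ℂ) * cexp (-(c k * x))))
    (fun k ↦ (integrableOn_mul_cexp_neg_mul (hc k)).const_mul 2) (by
      refine ((summable_inv_odd_pi_sub_sq ha).mul_left 2).congr fun k ↦ ?_
      rw [← hcre, ← integral_mul_exp_neg_mul (hc k), ← integral_const_mul]
      refine setIntegral_congr_fun measurableSet_Ioi fun x hx ↦ ?_
      rw [norm_mul, norm_mul_cexp_neg_mul _ (le_of_lt hx), norm_ofNat])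
  convert! h using 1
  · ext k
    rw [integral_const_mul, integral_mul_cexp_neg_mul (hc k), mul_one_div]
  · refine setIntegral_congr_fun measurableSet_Ioi fun x hx ↦ ?_
    have hx : 0 < x := hx
    have hs : HasSum (fun k : ℕ ↦ (x : ℂ) * cexp (a * x) *
        ((2 * Real.exp (-((2 * k + 1) * π * x)) : ℝ) : ℂ)) (sinhKernel a x) := by
      convert! (hasSum_ofReal.mpr (hasSum_exp_div_sinh hx)).mul_left ((x : ℂ) * cexp (a * x))
        using 1
      rw [sinhKernel, xDivSinh_of_ne_zero hx.ne']
      push_cast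
      ring
    rw [← hs.tsum_eq]
    refine tsum_congr fun k ↦ ?_
    have : cexp (-(c k * x)) = cexp (a * x) * cexp (-((2 * k + 1) * π * x)) := by
      rw [← Complex.exp_add]
      congr 1
      simp only [c]
      ring
    rw [this]
    push_cast
    ring

/-- Partial fraction expansion of the integral of the kernel. -/
lemma hasSum_integral_sinhKernel {a : ℂ} (ha : |a.re| < π) :
    HasSum (fun k : ℤ ↦ 2 / ((2 * k + 1) * π + a) ^ 2) (∫ x, sinhKernel a x) := by
  have hint := integrable_sinhKernel ha
  rw [abs_lt] at ha
  have hneg : ∫ x in Iic 0, sinhKernel a x = ∫ x in Ioi 0, sinhKernel (-a) x := by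
    simp_rw [← sinhKernel_neg]
    rw [integral_comp_neg_Ioi, neg_zero]
  rw [← intervalIntegral.integral_Iic_add_Ioi hint.integrableOn hint.integrableOn, hneg]
  refine HasSum.of_nat_of_neg_add_one ?_ ?_
  · simpa using hasSum_integral_Ioi_sinhKernel (a := -a) (by simp; linarith)
  · convert! hasSum_integral_Ioi_sinhKernel ha.2 using 3 with k
    push_cast
    ring

/-- The integral of the kernel as a power series in `-exp (i a)`. -/
lemma integral_sinhKernel {a : ℂ} (ha : |a.re| < π) (him : 0 < a.im) :
    ∫ x, sinhKernel a x = -2 * ∑' n : ℕ, ((n : ℂ) + 1) * (-cexp (I * a)) ^ (n + 1) := by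
  have hpi : (π : ℂ) ≠ 0 := ofReal_ne_zero.mpr Real.pi_ne_zero
  have hw : 0 < (1 / 2 + a / (2 * π)).im := by
    have : 1 / 2 + a / (2 * π) = ((1 / 2 : ℝ) : ℂ) + a / ((2 * π : ℝ) : ℂ) := by push_cast; rfl
    rw [this, add_im, ofReal_im, div_ofReal_im, zero_add]
    positivity
  have hexp : cexp (2 * π * I * (1 / 2 + a / (2 * π))) = -cexp (I * a) := by
    have : 2 * π * I * (1 / 2 + a / (2 * π)) = π * I + I * a := by field_simp
    rw [this, Complex.exp_add, exp_pi_mul_I, neg_one_mul]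
  have hnorm : ‖-cexp (I * a)‖ < 1 := by
    rw [norm_neg, norm_exp, Real.exp_lt_one_iff]
    simpa using him
  have hq := EisensteinSeries.qExpansion_identity (k := 1) le_rfl ⟨_, hw⟩
  simp only [hexp, Nat.reduceAdd, pow_one, Nat.factorial_one, Nat.cast_one,
    div_one] at hq
  have hsum : Summable fun n : ℕ ↦ (n : ℂ) * (-cexp (I * a)) ^ n := by
    simpa using summable_pow_mul_geometric_of_norm_lt_one 1 hnorm
  rw [hsum.tsum_eq_zero_add] at hq
  simp only [Nat.cast_zero, zero_mul, zero_add, Nat.cast_add, Nat.cast_one] at hq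
  have hterm (k : ℤ) : 2 / ((2 * k + 1) * π + a) ^ 2 =
      1 / (2 * π ^ 2) * (1 / (1 / 2 + a / (2 * π) + k) ^ 2) := by
    have : (2 * k + 1) * π + a = 2 * π * (1 / 2 + a / (2 * π) + k) := by field_simp; ring
    rw [this, mul_pow]
    generalize (1 / 2 + a / (2 * π) + (k : ℂ)) ^ 2 = y
    ring
  rw [← (hasSum_integral_sinhKernel ha).tsum_eq, tsum_congr hterm, tsum_mul_left, hq]
  field_simp
  rw [I_sq]
  ring

lemma fourier_sinhKernel (a : ℂ) (t : ℝ) :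
    𝓕 (sinhKernel a) t = ∫ x, sinhKernel (a - 2 * π * t * I) x := by
  rw [Real.fourier_real_eq_integral_exp_smul]
  congr 1 with x
  rw [sinhKernel, sinhKernel, smul_eq_mul, mul_left_comm, ← Complex.exp_add]
  congr 2
  push_cast
  ring

lemma integral_sinhKernel_neg (a : ℂ) : ∫ x, sinhKernel (-a) x = ∫ x, sinhKernel a x := by
  simp_rw [← sinhKernel_neg]
  exact integral_neg_eq_self _ _

lemma hasSum_cexp_div_sinh (m : ℕ) :
    HasSum (fun j : ℕ ↦ 2 * cexp (-((m + 1) * (2 * j + 1) * π))) (sinh ((m + 1) * π))⁻¹ := by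
  convert! hasSum_ofReal.mpr (hasSum_exp_div_sinh (x := m + 1) (by positivity)) using 1
  · ext j
    push_cast
    ring_nf
  · push_cast
    ring_nf

/-- The terms of the Fourier expansion of the kernel, summed in both orders. -/
lemma hasSum_integral_sinhKernel_odd {z : ℂ} (him : |z.im| < 1 / 2) (hre : |z.re| < 1 / 2) :
    HasSum (fun j : ℕ ↦ ∫ x, sinhKernel (2 * π * z + (2 * j + 1) * π * I) x)
      (-∑' m : ℕ, (-1 : ℂ) ^ (m + 1) * ((m : ℂ) + 1) * cexp (2 * (m + 1) * π * z * I) /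
        sinh ((m + 1) * π)) := by
  have hpi := Real.pi_pos
  rw [abs_lt] at him
  let F (p : ℕ × ℕ) : ℂ := (-1) ^ (p.2 + 1) * (p.2 + 1) * cexp (2 * (p.2 + 1) * π * z * I) *
    (2 * cexp (-((p.2 + 1) * (2 * p.1 + 1) * π)))
  let r : ℝ := Real.exp (-(2 * π * z.im + π))
  have hr : r < 1 := Real.exp_lt_one_iff.mpr (by nlinarith)
  have hF : Summable F := by
    have h1 : Summable fun m : ℕ ↦ 2 * (((m + 1 : ℕ) : ℝ) * r ^ (m + 1)) := by
      have := summable_pow_mul_geometric_of_norm_lt_one 1 (r := r)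
        (by rwa [Real.norm_of_nonneg (Real.exp_pos _).le])
      simp only [pow_one] at this
      exact ((summable_nat_add_iff 1).mpr this).mul_left 2
    have h2 : Summable fun j : ℕ ↦ Real.exp (-(2 * π)) ^ j :=
      summable_geometric_of_lt_one (Real.exp_pos _).le (Real.exp_lt_one_iff.mpr (by linarith))
    refine .of_norm_bounded (h2.mul_of_nonneg h1 (fun _ ↦ by positivity)
      (fun _ ↦ by positivity)) ?_
    rintro ⟨j, m⟩
    have hm : ‖(m : ℂ) + 1‖ = m + 1 := by exact_mod_cast norm_natCast (m + 1)
    have he1 : (2 * ((m : ℂ) + 1) * π * z * I).re = -(2 * (m + 1) * π * z.im) := by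
      have : 2 * ((m : ℂ) + 1) * π * z * I = ((2 * (m + 1) * π : ℝ) : ℂ) * (z * I) := by
        push_cast; ring
      rw [this, re_ofReal_mul]
      simp
    have he2 : (-(((m : ℂ) + 1) * (2 * j + 1) * π)).re = -((m + 1) * (2 * j + 1) * π) := by
      have : -(((m : ℂ) + 1) * (2 * j + 1) * π) = ((-((m + 1) * (2 * j + 1) * π) : ℝ) : ℂ) := by
        push_cast; ring
      rw [this, ofReal_re]
    simp only [F, norm_mul, norm_pow, norm_neg, norm_one, one_pow, one_mul, hm, norm_exp, he1, he2,
      norm_ofNat, r, ← Real.exp_nat_mul]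
    push_cast
    calc _ = 2 * ((m + 1) * Real.exp (-(2 * (m + 1) * π * z.im) + -((m + 1) * (2 * j + 1) * π))) := by
          rw [Real.exp_add]; ring
      _ ≤ 2 * ((m + 1) * Real.exp (j * -(2 * π) + (m + 1) * -(2 * π * z.im + π))) := by
          gcongr 2 * (_ * Real.exp ?_)
          have : 0 ≤ (m : ℝ) * j * π := by positivity
          linarith
      _ = _ := by rw [Real.exp_add]; ring
  have hcomm : HasSum (fun p : ℕ × ℕ ↦ F p.swap) (∑' p, F p) :=
    (Equiv.prodComm ℕ ℕ).hasSum_iff.mpr hF.hasSum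
  have hm := hcomm.prod_fiberwise fun m ↦ (hasSum_cexp_div_sinh m).mul_left
    ((-1) ^ (m + 1) * ((m : ℂ) + 1) * cexp (2 * (m + 1) * π * z * I))
  simp only [← div_eq_mul_inv] at hm
  have hj := hF.hasSum.prod_fiberwise fun j ↦ (hF.prod_factor j).hasSum
  rw [hm.tsum_eq]
  convert! hj.neg using 1
  ext j
  have hbre : (2 * π * z + (2 * j + 1) * π * I).re = 2 * π * z.re := by
    have : 2 * π * z + (2 * j + 1) * π * I =
      ((2 * π : ℝ) : ℂ) * z + (((2 * j + 1) * π : ℝ) : ℂ) * I := by push_cast; ring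
    rw [this, add_re, re_ofReal_mul, re_ofReal_mul]
    simp
  have hbim : (2 * π * z + (2 * j + 1) * π * I).im = 2 * π * z.im + (2 * j + 1) * π := by
    have : 2 * π * z + (2 * j + 1) * π * I =
      ((2 * π : ℝ) : ℂ) * z + (((2 * j + 1) * π : ℝ) : ℂ) * I := by push_cast; ring
    rw [this, add_im, im_ofReal_mul, im_ofReal_mul]
    simp
  rw [integral_sinhKernel, neg_mul, neg_inj, ← tsum_mul_left]
  · refine tsum_congr fun m ↦ ?_
    simp only [F]
    rw [neg_pow, ← Complex.exp_nat_mul]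
    have : ((m + 1 : ℕ) : ℂ) * (I * (2 * π * z + (2 * j + 1) * π * I)) =
        2 * (m + 1) * π * z * I + -((m + 1) * (2 * j + 1) * π) := by
      push_cast
      linear_combination (m + 1) * (2 * j + 1) * π * I_sq
    rw [this, Complex.exp_add]
    ring
  · rw [hbre, abs_mul, abs_of_pos (by positivity)]
    nlinarith
  · rw [hbim]
    have : 0 ≤ (j : ℝ) * π := by positivity
    nlinarith

lemma summable_sinhKernel_int {a : ℂ} (ha : |a.re| < π) :
    Summable fun n : ℤ ↦ sinhKernel a n :=
  summable_of_isBigO (Real.summable_abs_int_rpow one_lt_two)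
    ((isBigO_sinhKernel ha).comp_tendsto Int.tendsto_coe_cofinite)

lemma sinhKernel_add_one (b : ℂ) (m : ℕ) :
    sinhKernel (b - π * I) (m + 1) =
      (-1 : ℂ) ^ (m + 1) * ((m : ℂ) + 1) * cexp ((m + 1) * b) / sinh ((m + 1) * π) := by
  have hexp : cexp ((b - π * I) * ((m : ℂ) + 1)) = (-1) ^ (m + 1) * cexp ((m + 1) * b) := by
    have h1 : cexp (-(π * I)) = -1 := by rw [Complex.exp_neg, exp_pi_mul_I]; norm_num
    rw [← h1, ← Complex.exp_nat_mul, ← Complex.exp_add]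
    push_cast
    ring_nf
  rw [sinhKernel, xDivSinh_of_ne_zero (by positivity)]
  push_cast
  rw [hexp, mul_comm (π : ℂ)]
  ring

lemma sinhKernel_neg_add_one (b : ℂ) (m : ℕ) :
    sinhKernel (b - π * I) (-(m + 1)) = sinhKernel (-b - π * I) (m + 1) := by
  have hexp : cexp (((m + 1 : ℕ) : ℂ) * (2 * π * I)) = 1 := by
    exact_mod_cast exp_int_mul_two_pi_mul_I (m + 1 : ℕ)
  rw [sinhKernel_neg, sinhKernel, sinhKernel, ← mul_one (cexp ((-b - _) * _)), ← hexp,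
    ← Complex.exp_add]
  push_cast
  ring_nf

lemma summable_exp_div_sinh {b : ℂ} (hb : |b.re| < π) :
    Summable fun m : ℕ ↦
      (-1 : ℂ) ^ (m + 1) * ((m : ℂ) + 1) * cexp ((m + 1) * b) / sinh ((m + 1) * π) := by
  have h := (summable_sinhKernel_int (a := b - π * I) (by simpa using hb)).comp_injective
    (i := fun m : ℕ ↦ (m + 1 : ℤ)) fun _ _ h ↦ by simpa using h
  refine h.congr fun m ↦ ?_
  rw [← sinhKernel_add_one]
  simp

lemma tsum_exp_add_tsum_exp_neg {b : ℂ} (hb : |b.re| < π) :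
    ∑' m : ℕ, (-1 : ℂ) ^ (m + 1) * ((m : ℂ) + 1) * cexp ((m + 1) * b) / sinh ((m + 1) * π) +
      ∑' m : ℕ, (-1 : ℂ) ^ (m + 1) * ((m : ℂ) + 1) * cexp ((m + 1) * -b) / sinh ((m + 1) * π) =
    2 * ∑' m : ℕ, (-1 : ℂ) ^ (m + 1) * ((m : ℂ) + 1) * cosh ((m + 1) * b) /
      sinh ((m + 1) * π) := by
  rw [← (summable_exp_div_sinh hb).tsum_add (summable_exp_div_sinh (by simpa using hb)),
    ← tsum_mul_left]
  refine tsum_congr fun m ↦ ?_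
  rw [Complex.cosh, mul_neg]
  ring

lemma tsum_sinhKernel_int {b : ℂ} (hb : |b.re| < π) :
    ∑' n : ℤ, sinhKernel (b - π * I) n = 1 / π + 2 * ∑' m : ℕ,
      (-1 : ℂ) ^ (m + 1) * ((m : ℂ) + 1) * cosh ((m + 1) * b) / sinh ((m + 1) * π) := by
  have h0 : sinhKernel (b - π * I) ((0 : ℤ) : ℝ) = 1 / π := by simp [sinhKernel, xDivSinh_zero]
  have h := HasSum.of_add_one_of_neg_add_one (f := fun n : ℤ ↦ sinhKernel (b - π * I) n)
    (m := ∑' m : ℕ, (-1 : ℂ) ^ (m + 1) * ((m : ℂ) + 1) * cexp ((m + 1) * b) / sinh ((m + 1) * π))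
    (m' := ∑' m : ℕ, (-1 : ℂ) ^ (m + 1) * ((m : ℂ) + 1) * cexp ((m + 1) * -b) /
      sinh ((m + 1) * π))
    (by
      push_cast
      simp_rw [sinhKernel_add_one]
      exact (summable_exp_div_sinh hb).hasSum)
    (by
      push_cast
      simp_rw [sinhKernel_neg_add_one, sinhKernel_add_one]
      exact (summable_exp_div_sinh (by simpa using hb)).hasSum)
  rw [h.tsum_eq, h0, ← tsum_exp_add_tsum_exp_neg hb]
  ring

lemma hasSum_fourier_sinhKernel {z : ℂ} (him : |z.im| < 1 / 2) (hre : |z.re| < 1 / 2) :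
    HasSum (fun n : ℤ ↦ 𝓕 (sinhKernel (2 * π * z - π * I)) n)
      (-(2 * ∑' m : ℕ, (-1 : ℂ) ^ (m + 1) * ((m : ℂ) + 1) * cosh ((m + 1) * (2 * π * z * I)) /
        sinh ((m + 1) * π))) := by
  have hb : |(2 * π * z * I).re| < π := by
    have : 2 * π * z * I = ((2 * π : ℝ) : ℂ) * (z * I) := by push_cast; ring
    rw [this, re_ofReal_mul, mul_I_re, abs_mul, abs_neg, abs_of_pos (by positivity)]
    nlinarith [Real.pi_pos]
  have hpos := hasSum_integral_sinhKernel_odd (z := -z) (by simpa using him) (by simpa using hre)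
  have hneg := hasSum_integral_sinhKernel_odd him hre
  rw [← tsum_exp_add_tsum_exp_neg hb, add_comm, neg_add]
  refine HasSum.of_nat_of_neg_add_one ?_ ?_
  · convert! hpos using 1
    · ext j
      rw [fourier_sinhKernel, ← integral_sinhKernel_neg]
      congr 2
      push_cast
      ring_nf
    · congr 1
      refine tsum_congr fun m ↦ ?_
      ring_nf
  · convert! hneg using 1
    · ext j
      rw [fourier_sinhKernel]
      congr 2
      push_cast
      ring_nf
    · congr 1
      refine tsum_congr fun m ↦ ?_
      ring_nf

theorem stmt0 (z : ℂ) (him : |z.im| < 1/2) (hre : |z.re| < 1/2) :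
    (1 / (4 * (π : ℂ))) + ∑' n : ℕ, (-1 : ℂ) ^ (n + 1) * ((n : ℂ) + 1) *
        Complex.cos (2 * ((n : ℂ) + 1) * π * z) / Complex.sinh (((n : ℂ) + 1) * π)
      = -(1 / (4 * (π : ℂ))) - ∑' n : ℕ, (-1 : ℂ) ^ (n + 1) * ((n : ℂ) + 1) *
        Complex.cosh (2 * ((n : ℂ) + 1) * π * z) / Complex.sinh (((n : ℂ) + 1) * π) := by
  have hb : |(2 * π * z).re| < π := by
    have : 2 * π * z = ((2 * π : ℝ) : ℂ) * z := by push_cast; ring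
    rw [this, re_ofReal_mul, abs_mul, abs_of_pos (by positivity)]
    nlinarith [Real.pi_pos]
  have hfourier := hasSum_fourier_sinhKernel him hre
  have hpoisson := Real.tsum_eq_tsum_fourier_of_rpow_decay_of_summable
    (continuous_sinhKernel (2 * π * z - π * I)) one_lt_two
    (isBigO_sinhKernel (by simpa using hb)) hfourier.summable 0
  simp only [zero_add, QuotientAddGroup.mk_zero, fourier_eval_zero, mul_one] at hpoisson
  rw [tsum_sinhKernel_int hb, hfourier.tsum_eq] at hpoisson
  have hcos (n : ℕ) : cos (2 * ((n : ℂ) + 1) * π * z) = cosh ((n + 1) * (2 * π * z * I)) := by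
    rw [← cosh_mul_I]
    ring_nf
  have hcosh (n : ℕ) : cosh (2 * ((n : ℂ) + 1) * π * z) = cosh ((n + 1) * (2 * π * z)) := by
    ring_nf
  simp_rw [hcos, hcosh]
  linear_combination hpoisson / 2
end

section
/- Σ_{n=1}^∞ (-1)^n n / sinh(nπ) = -1/(4π). -/
open scoped Real

open EisensteinSeries UpperHalfPlane ModularGroup

/-- The Lambert series expansion of the weight-2 Eisenstein series. -/
lemma G2_eq_lambert_series (z : ℍ) {q : ℂ} (hq : Complex.exp (2 * π * Complex.I * z) = q) :
    G2 z = π ^ 2 / 3 - 8 * π ^ 2 *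
      ∑' n : ℕ, ((n : ℂ) + 1) * q ^ (n + 1) / (1 - q ^ (n + 1)) := by
  have hq1 : ‖q‖ < 1 := hq ▸ norm_exp_two_pi_I_lt_one z
  rw [G2_eq_tsum_cexp, hq, ← tsum_pow_div_one_sub_eq_tsum_sigma hq1,
    tsum_pnat_eq_tsum_succ (f := fun n : ℕ ↦ (n : ℂ) ^ 1 * q ^ n / (1 - q ^ n)),
    riemannZeta_two]
  simp only [pow_one, Nat.cast_add, Nat.cast_one]
  ring

lemma summable_lambert_series {q : ℂ} (hq : ‖q‖ < 1) :
    Summable fun n : ℕ ↦ ((n : ℂ) + 1) * q ^ (n + 1) / (1 - q ^ (n + 1)) := by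
  have h := summable_norm_pow_mul_geometric_div_one_sub 1 hq
  rw [← summable_nat_add_iff 1] at h
  simpa only [pow_one, Nat.cast_add, Nat.cast_one] using h

lemma div_one_sub_sub_sq_div_one_sub_sq {K : Type*} [Field K] {x : K} (hx : x ^ 2 ≠ 1) :
    x / (1 - x) - x ^ 2 / (1 - x ^ 2) = x / (1 - x ^ 2) := by
  have h1 : 1 - x ^ 2 ≠ 0 := sub_ne_zero.mpr hx.symm
  have h2 : 1 - x ≠ 0 := fun h ↦ h1 (by linear_combination (1 + x) * h)
  field_simp
  ring

/-- The difference between the Eisenstein series of weight 2 at the nomes `q ^ 2` and `q`. -/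
lemma G2_sub_G2_eq_tsum (z w : ℍ) {q : ℂ} (hz : Complex.exp (2 * π * Complex.I * z) = q)
    (hw : Complex.exp (2 * π * Complex.I * w) = q ^ 2) :
    G2 w - G2 z = 8 * π ^ 2 *
      ∑' n : ℕ, ((n : ℂ) + 1) * (q ^ (n + 1) / (1 - (q ^ (n + 1)) ^ 2)) := by
  have hq : ‖q‖ < 1 := hz ▸ norm_exp_two_pi_I_lt_one z
  have hq2 : ‖q ^ 2‖ < 1 := hw ▸ norm_exp_two_pi_I_lt_one w
  have hne (n : ℕ) : (q ^ (n + 1)) ^ 2 ≠ 1 := by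
    intro h
    have h1 : ‖q‖ ^ ((n + 1) * 2) < 1 := pow_lt_one₀ (norm_nonneg _) hq (by positivity)
    rw [← norm_pow, pow_mul, h, norm_one] at h1
    exact lt_irrefl _ h1
  rw [G2_eq_lambert_series z hz, G2_eq_lambert_series w hw, sub_sub_sub_cancel_left, ← mul_sub,
    ← (summable_lambert_series hq).tsum_sub (summable_lambert_series hq2)]
  congr 1
  refine tsum_congr fun n ↦ ?_
  rw [← div_one_sub_sub_sq_div_one_sub_sq (hne n), pow_right_comm]
  ring

lemma G2_I : G2 UpperHalfPlane.I = π := by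
  have h := G2_S_transform UpperHalfPlane.I
  have hS : S • UpperHalfPlane.I = UpperHalfPlane.I := by
    rw [modular_S_smul]
    ext
    simp
  rw [hS, UpperHalfPlane.coe_I, Complex.I_sq] at h
  field_simp at h
  linear_combination h / 2

/-- The point `(1 + i) / 2` of the upper half-plane. -/
noncomputable def halfOneAddI : ℍ := ⟨(1 + Complex.I) / 2, by simp⟩

lemma coe_halfOneAddI : (halfOneAddI : ℂ) = (1 + Complex.I) / 2 := rfl

lemma exp_two_pi_I_mul_I :
    Complex.exp (2 * π * Complex.I * UpperHalfPlane.I) = (-(Real.exp (-π) : ℂ)) ^ 2 := by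
  rw [UpperHalfPlane.coe_I, neg_sq, Complex.ofReal_exp, ← Complex.exp_nat_mul]
  congr 1
  push_cast
  linear_combination 2 * π * Complex.I_sq

lemma exp_two_pi_I_mul_halfOneAddI :
    Complex.exp (2 * π * Complex.I * halfOneAddI) = -(Real.exp (-π) : ℂ) := by
  rw [coe_halfOneAddI, show 2 * π * Complex.I * ((1 + Complex.I) / 2) =
    π * Complex.I + (-π : ℝ) by push_cast; linear_combination π * Complex.I_sq,
    Complex.exp_add, Complex.exp_pi_mul_I, Complex.ofReal_exp, neg_one_mul]

lemma coe_S_smul_halfOneAddI : ((S • halfOneAddI : ℍ) : ℂ) = Complex.I - 1 := by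
  rw [modular_S_smul]
  change (-((1 + Complex.I) / 2))⁻¹ = Complex.I - 1
  refine inv_eq_of_mul_eq_one_right ?_
  linear_combination -Complex.I_sq / 2

lemma G2_halfOneAddI : G2 halfOneAddI = 2 * π := by
  have hS : G2 (S • halfOneAddI) = π := by
    rw [← G2_I, G2_eq_tsum_cexp, G2_eq_tsum_cexp, coe_S_smul_halfOneAddI, mul_sub, mul_one,
      Complex.exp_periodic.sub_eq, UpperHalfPlane.coe_I]
  have hne : (1 + Complex.I) ≠ 0 := fun h ↦ by simpa using congrArg Complex.re h
  rw [G2_S_transform, hS, coe_halfOneAddI]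
  field_simp
  linear_combination Complex.I_sq

lemma exp_neg_div_one_sub_sq (x : ℝ) :
    Real.exp (-x) / (1 - Real.exp (-x) ^ 2) = 1 / (2 * Real.sinh x) := by
  have h : Real.exp (-x) * Real.exp x = 1 := by rw [← Real.exp_add]; simp
  rw [Real.sinh_eq, mul_div_cancel₀ _ two_ne_zero,
    ← mul_div_mul_left 1 _ (Real.exp_pos (-x)).ne', mul_sub, h, mul_one, sq]

theorem stmt1 :
    ∑' n : ℕ, (-1 : ℝ) ^ (n + 1) * ((n : ℝ) + 1) / Real.sinh (((n : ℝ) + 1) * π)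
      = -1 / (4 * π) := by
  have hterm (n : ℕ) :
      (-1 : ℝ) ^ (n + 1) * ((n : ℝ) + 1) / Real.sinh (((n : ℝ) + 1) * π) =
        2 * (((n : ℝ) + 1) * ((-Real.exp (-π)) ^ (n + 1) /
          (1 - ((-Real.exp (-π)) ^ (n + 1)) ^ 2))) := by
    have hpow : Real.exp (-π) ^ (n + 1) = Real.exp (-(((n : ℝ) + 1) * π)) := by
      rw [← Real.exp_nat_mul]
      push_cast
      ring_nf
    have hsq : ((-1 : ℝ) ^ (n + 1)) ^ 2 = 1 := by rw [← pow_mul', pow_mul]; simp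
    rw [neg_pow (Real.exp (-π)), mul_pow, hsq, one_mul, hpow, mul_div_assoc ((-1) ^ (n + 1)) (Real.exp _),
      exp_neg_div_one_sub_sq]
    ring
  have key := G2_sub_G2_eq_tsum halfOneAddI UpperHalfPlane.I exp_two_pi_I_mul_halfOneAddI
    exp_two_pi_I_mul_I
  rw [G2_I, G2_halfOneAddI] at key
  norm_cast at key
  simp_rw [hterm]
  rw [tsum_mul_left]
  have hpi := Real.pi_ne_zero
  rw [eq_div_iff (by positivity)]
  refine mul_left_cancel₀ hpi ?_
  push_cast at key
  linear_combination -key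
end

section
/- For Im τ > 0 and z = α + βτ with α, β ∈ ℝ, |β| < 1/2 and |α| < 1/2, the residue identity 1/(2π) + τ Σ_{n=1}^∞ (-1)^n n cos(2nπz)/sin(nπτ) + (1/τ) Σ_{n=1}^∞ (-1)^n n cos(2nπz/τ)/sin(nπ/τ) = 0 holds. -/
open scoped Real
open Complex Filter Topology

/-- The point `(x + m) + (y + k) τ` of the translate by `x + y τ` of the lattice `ℤ + ℤ τ`. -/
noncomputable def latticePoint (τ : ℂ) (x y : ℝ) (m k : ℤ) : ℂ :=
  ((x + m : ℝ) : ℂ) + ((y + k : ℝ) : ℂ) * τ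

lemma mul_abs_mul_abs_le_norm_sq {τ : ℂ} (hτ : 0 < τ.im) (x y : ℝ) :
    τ.im ^ 2 / ‖τ‖ * (|x| * |y|) ≤ ‖(x : ℂ) + y * τ‖ ^ 2 := by
  have hτ0 : 0 < ‖τ‖ := norm_pos_iff.2 fun h => by simp [h] at hτ
  have hy : |y| * τ.im ≤ ‖(x : ℂ) + y * τ‖ := by
    have h := Complex.abs_im_le_norm ((x : ℂ) + y * τ)
    simpa [abs_mul, abs_of_pos hτ] using h
  have hx : |x| * (τ.im / ‖τ‖) ≤ ‖(x : ℂ) + y * τ‖ := by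
    have h := Complex.abs_im_le_norm (((x : ℂ) + y * τ) * (starRingEnd ℂ) τ)
    have e : (((x : ℂ) + y * τ) * (starRingEnd ℂ) τ).im = -(x * τ.im) := by
      simp; ring
    rw [e, norm_mul, RCLike.norm_conj, abs_neg, abs_mul, abs_of_pos hτ] at h
    rw [← mul_div_assoc, div_le_iff₀ hτ0]
    exact h
  calc τ.im ^ 2 / ‖τ‖ * (|x| * |y|) = (|x| * (τ.im / ‖τ‖)) * (|y| * τ.im) := by ring
    _ ≤ ‖(x : ℂ) + y * τ‖ * ‖(x : ℂ) + y * τ‖ := by gcongr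
    _ = _ := by ring

lemma add_intCast_ne_zero {x : ℝ} (hx0 : 0 < x) (hx1 : x < 1) (m : ℤ) : x + m ≠ 0 := by
  intro h
  have h1 : (m : ℝ) < 0 := by linarith
  have h2 : (-1 : ℝ) < m := by linarith
  have h3 : m < 0 := by exact_mod_cast h1
  have h4 : -1 < m := by exact_mod_cast h2
  omega

section

variable {τ : ℂ} {x y : ℝ}

lemma latticePoint_ne_zero (hτ : 0 < τ.im) (hy0 : 0 < y) (hy1 : y < 1) (m k : ℤ) :
    latticePoint τ x y m k ≠ 0 := by
  intro h
  have := congrArg Complex.im h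
  simp only [latticePoint, add_im, ofReal_im, zero_add, im_ofReal_mul, zero_im, mul_eq_zero] at this
  exact this.elim (add_intCast_ne_zero hy0 hy1 k) hτ.ne'

lemma latticePoint_add_one (m k : ℤ) :
    latticePoint τ x y (m + 1) k = latticePoint τ x y m k + 1 := by
  simp only [latticePoint]; push_cast; ring

lemma summable_inv_norm_latticePoint_pow_three (hτ : 0 < τ.im) (hx0 : 0 < x) (hx1 : x < 1)
    (hy0 : 0 < y) (hy1 : y < 1) :
    Summable fun p : ℤ × ℤ => (‖latticePoint τ x y p.1 p.2‖ ^ 3)⁻¹ := by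
  have hτ0 : 0 < ‖τ‖ := norm_pos_iff.2 fun h => by simp [h] at hτ
  set c : ℝ := τ.im ^ 2 / ‖τ‖ with hc
  have hcpos : 0 < c := by positivity
  have h1 (a : ℝ) : Summable fun n : ℤ => 1 / |(n : ℝ) + a| ^ (3 / 2 : ℝ) :=
    (Real.summable_one_div_int_add_rpow a _).2 (by norm_num)
  have hprod := ((h1 x).mul_of_nonneg (h1 y) (fun _ => by positivity)
    (fun _ => by positivity)).mul_left (1 / c ^ (3 / 2 : ℝ))
  refine Summable.of_nonneg_of_le (fun _ => by positivity) (fun p => ?_) hprod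
  have hm : 0 < |(p.1 : ℝ) + x| := by
    rw [add_comm]; exact abs_pos.2 (add_intCast_ne_zero hx0 hx1 _)
  have hk : 0 < |(p.2 : ℝ) + y| := by
    rw [add_comm]; exact abs_pos.2 (add_intCast_ne_zero hy0 hy1 _)
  have hle := mul_abs_mul_abs_le_norm_sq hτ ((p.1 : ℝ) + x) ((p.2 : ℝ) + y)
  rw [← hc] at hle
  have hpow : ‖latticePoint τ x y p.1 p.2‖ ^ 3
      = (‖latticePoint τ x y p.1 p.2‖ ^ 2) ^ (3 / 2 : ℝ) := by
    rw [← Real.rpow_natCast, ← Real.rpow_natCast, ← Real.rpow_mul (norm_nonneg _)]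
    norm_num
  have hlp : latticePoint τ x y p.1 p.2
      = (((p.1 : ℝ) + x : ℝ) : ℂ) + (((p.2 : ℝ) + y : ℝ) : ℂ) * τ := by
    simp only [latticePoint, add_comm]
  rw [hpow, hlp, one_div_mul_one_div, one_div_mul_one_div, ← one_div,
    ← Real.mul_rpow hm.le hk.le, ← Real.mul_rpow hcpos.le (by positivity)]
  gcongr

lemma summable_inv_latticePoint_sq_mul (hτ : 0 < τ.im) (hx0 : 0 < x) (hx1 : x < 1)
    (hy0 : 0 < y) (hy1 : y < 1) :
    Summable fun p : ℤ × ℤ =>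
      (latticePoint τ x y p.1 p.2 ^ 2 * latticePoint τ x y (p.1 + 1) p.2)⁻¹ := by
  have h := summable_inv_norm_latticePoint_pow_three hτ hx0 hx1 hy0 hy1
  have h' : Summable fun p : ℤ × ℤ => (‖latticePoint τ x y (p.1 + 1) p.2‖ ^ 3)⁻¹ :=
    (((Equiv.addRight (1 : ℤ)).prodCongr (Equiv.refl ℤ)).summable_iff).2 h
  refine Summable.of_norm_bounded (h.add h') fun p => ?_
  rw [norm_inv, norm_mul, norm_pow, mul_inv, ← inv_pow, ← inv_pow, ← inv_pow]
  generalize hA : ‖latticePoint τ x y p.1 p.2‖⁻¹ = A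
  generalize hB : ‖latticePoint τ x y (p.1 + 1) p.2‖⁻¹ = B
  have hA0 : 0 ≤ A := hA ▸ by positivity
  have hB0 : 0 ≤ B := hB ▸ by positivity
  rcases le_total A B with h | h
  · have : A ^ 2 * B ≤ B ^ 2 * B := by gcongr
    nlinarith [pow_nonneg hA0 3]
  · have : A ^ 2 * B ≤ A ^ 2 * A := by gcongr
    nlinarith [pow_nonneg hB0 3]

lemma tsum_int_sub_succ {c : ℤ → ℂ} {l l' : ℂ} (h : Summable fun m : ℤ => c m - c (m + 1))
    (hl : Tendsto (fun n : ℕ => c n) atTop (𝓝 l))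
    (hl' : Tendsto (fun n : ℕ => c (-n)) atTop (𝓝 l')) :
    ∑' m : ℤ, (c m - c (m + 1)) = l' - l := by
  have h1 := h.hasSum.comp (Finset.tendsto_Ico_neg_atTop_atTop.comp (tendsto_natCast_atTop_atTop (R := ℤ)))
  refine tendsto_nhds_unique h1 ((hl'.sub hl).congr fun n => ?_)
  exact (Finset.sum_Ico_int_sub n c).symm

lemma summable_inv_add_int_sq (u : ℂ) : Summable fun m : ℤ => ((u + m) ^ 2)⁻¹ := by
  simpa using! EisensteinSeries.linear_right_summable u 1 (k := 2) le_rfl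

lemma summable_inv_latticePoint_sq_left (k : ℤ) :
    Summable fun m : ℤ => (latticePoint τ x y m k ^ 2)⁻¹ := by
  refine (summable_inv_add_int_sq (x + (y + k) * τ)).congr fun m => ?_
  simp only [latticePoint]; push_cast; ring_nf

lemma latticePoint_eq_mul (hτ : τ ≠ 0) (m k : ℤ) :
    latticePoint τ x y m k = τ * ((x + m) / τ + y + k) := by
  simp only [latticePoint]; push_cast; field_simp; ring

lemma summable_inv_latticePoint_sq_right (hτ : τ ≠ 0) (m : ℤ) :
    Summable fun k : ℤ => (latticePoint τ x y m k ^ 2)⁻¹ := by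
  refine ((summable_inv_add_int_sq ((x + m) / τ + y)).mul_left (τ ^ 2)⁻¹).congr fun k => ?_
  rw [latticePoint_eq_mul hτ, mul_pow, mul_inv]

lemma inv_latticePoint_sq (hτ : 0 < τ.im) (hy0 : 0 < y) (hy1 : y < 1) (m k : ℤ) :
    (latticePoint τ x y m k ^ 2)⁻¹ =
      (latticePoint τ x y m k ^ 2 * latticePoint τ x y (m + 1) k)⁻¹
        + ((latticePoint τ x y m k)⁻¹ - (latticePoint τ x y (m + 1) k)⁻¹) := by
  have h := latticePoint_ne_zero (x := x) hτ hy0 hy1 m k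
  have h' := latticePoint_ne_zero (x := x) hτ hy0 hy1 (m + 1) k
  rw [latticePoint_add_one] at h' ⊢
  field_simp
  ring

lemma tendsto_inv_add_nat (u : ℂ) : Tendsto (fun n : ℕ => (u + n)⁻¹) atTop (𝓝 0) := by
  refine tendsto_inv₀_cobounded.comp ?_
  rw [← tendsto_norm_atTop_iff_cobounded]
  have h : Tendsto (fun n : ℕ => (n : ℝ) - ‖u‖) atTop atTop :=
    tendsto_atTop_add_const_right _ _ tendsto_natCast_atTop_atTop
  refine tendsto_atTop_mono (fun n => ?_) h
  have := norm_sub_norm_le (n : ℂ) (-u)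
  simpa [add_comm] using this

lemma tsum_inv_sub_inv_eq_cot {u v : ℂ} (hu : u ∈ Complex.integerComplement)
    (hv : v ∈ Complex.integerComplement) (h : Summable fun k : ℤ => (u + k)⁻¹ - (v + k)⁻¹) :
    ∑' k : ℤ, ((u + k)⁻¹ - (v + k)⁻¹) = π * cot (π * u) - π * cot (π * v) := by
  have h1 := tsum_nat_add_neg h
  have h2 : Summable fun n : ℕ => ((u + (n : ℤ))⁻¹ - (v + (n : ℤ))⁻¹)
      + ((u + ((-n : ℤ) : ℂ))⁻¹ - (v + ((-n : ℤ) : ℂ))⁻¹) := h.hasSum.nat_add_neg.summable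
  rw [h2.tsum_eq_zero_add] at h1
  have h3 : ∑' n : ℕ, (((u + ((n + 1 : ℕ) : ℤ))⁻¹ - (v + ((n + 1 : ℕ) : ℤ))⁻¹)
      + ((u + ((-(n + 1 : ℕ) : ℤ) : ℂ))⁻¹ - (v + ((-(n + 1 : ℕ) : ℤ) : ℂ))⁻¹))
      = (π * cot (π * u) - 1 / u) - (π * cot (π * v) - 1 / v) := by
    rw [cot_series_rep' hu, cot_series_rep' hv,
      ← (summable_cotTerm hu).tsum_sub (summable_cotTerm hv)]
    refine tsum_congr fun n => ?_
    simp only [cotTerm]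
    push_cast
    simp only [one_div]
    ring
  rw [h3] at h1
  simp at h1
  linear_combination -h1

lemma tendsto_cot_pi_add_nat_mul (u : ℂ) {s : ℂ} (hs : 0 < s.im) :
    Tendsto (fun n : ℕ => cot (π * (u + n * s))) atTop (𝓝 (-I)) := by
  have hq : ‖cexp (2 * π * I * s)‖ < 1 := UpperHalfPlane.norm_exp_two_pi_I_lt_one ⟨s, hs⟩
  have h0 : Tendsto (fun n : ℕ => cexp (2 * π * I * (u + n * s))) atTop (𝓝 0) := by
    have := (tendsto_pow_atTop_nhds_zero_of_norm_lt_one hq).const_mul (cexp (2 * π * I * u))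
    rw [mul_zero] at this
    refine this.congr fun n => ?_
    rw [← Complex.exp_nat_mul, ← Complex.exp_add]
    ring_nf
  simp_rw [Complex.cot_pi_eq_exp_ratio]
  have h1 : (-I : ℂ) = (0 + 1) / (I * (1 - 0)) := by simp
  rw [h1]
  exact (h0.add_const 1).div ((h0.const_sub 1).const_mul I) (by simp)

lemma add_div_add_mem_integerComplement (hτ : 0 < τ.im) (hx0 : 0 < x) (hx1 : x < 1) (m : ℤ) :
    (x + m) / τ + y ∈ Complex.integerComplement := by
  have hτ0 : τ ≠ 0 := fun h => by simp [h] at hτ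
  rintro ⟨n, hn⟩
  have h1 : ((x + m : ℝ) : ℂ) = ((n - y : ℝ) : ℂ) * τ := by
    have : (n : ℂ) - y = (x + m) / τ := by rw [hn]; simp
    push_cast
    rw [this]; field_simp
  have h2 := congrArg Complex.im h1
  have h3 := congrArg Complex.re h1
  simp only [ofReal_im, im_ofReal_mul] at h2
  have h4 : (n : ℝ) - y = 0 := by
    rcases mul_eq_zero.1 h2.symm with h | h
    · exact h
    · exact absurd h hτ.ne'
  rw [h4] at h3
  simp only [ofReal_re, ofReal_zero, zero_mul, zero_re] at h3
  exact add_intCast_ne_zero hx0 hx1 m h3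

lemma im_neg_one_div_pos (hτ : 0 < τ.im) : 0 < (-1 / τ).im := by
  have hτ0 : τ ≠ 0 := fun h => by simp [h] at hτ
  rw [neg_div, one_div, neg_im, inv_im, neg_div, neg_neg]
  exact div_pos hτ (normSq_pos.2 hτ0)

lemma complex_cot_neg (u : ℂ) : cot (-u) = -cot u := by
  simp [Complex.cot, div_neg]

/-- The two iterated sums of the inverse squares over a translated lattice differ by
`2 π i / τ`. -/
lemma tsum_tsum_inv_latticePoint_sq (hτ : 0 < τ.im) (hx0 : 0 < x) (hx1 : x < 1)
    (hy0 : 0 < y) (hy1 : y < 1)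
    (hsum : Summable fun m : ℤ => ∑' k : ℤ, (latticePoint τ x y m k ^ 2)⁻¹) :
    ∑' k : ℤ, ∑' m : ℤ, (latticePoint τ x y m k ^ 2)⁻¹ =
      ∑' m : ℤ, ∑' k : ℤ, (latticePoint τ x y m k ^ 2)⁻¹ + 2 * π * I / τ := by
  have hτ0 : τ ≠ 0 := fun h => by simp [h] at hτ
  have hS := summable_inv_latticePoint_sq_mul hτ hx0 hx1 hy0 hy1
  have hSl (k : ℤ) : Summable fun m : ℤ =>
      (latticePoint τ x y m k ^ 2 * latticePoint τ x y (m + 1) k)⁻¹ := hS.prod_symm.prod_factor k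
  have hSr (m : ℤ) : Summable fun k : ℤ =>
      (latticePoint τ x y m k ^ 2 * latticePoint τ x y (m + 1) k)⁻¹ := hS.prod_factor m
  have hSp : Summable fun m : ℤ => ∑' k : ℤ,
      (latticePoint τ x y m k ^ 2 * latticePoint τ x y (m + 1) k)⁻¹ := hS.prod
  have hdiffl (k : ℤ) : Summable fun m : ℤ =>
      (latticePoint τ x y m k)⁻¹ - (latticePoint τ x y (m + 1) k)⁻¹ :=
    ((summable_inv_latticePoint_sq_left k).sub (hSl k)).congr fun m => by
      rw [inv_latticePoint_sq hτ hy0 hy1 m k]; exact add_sub_cancel_left _ _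
  have hdiffr (m : ℤ) : Summable fun k : ℤ =>
      (latticePoint τ x y m k)⁻¹ - (latticePoint τ x y (m + 1) k)⁻¹ :=
    ((summable_inv_latticePoint_sq_right hτ0 m).sub (hSr m)).congr fun k => by
      rw [inv_latticePoint_sq hτ hy0 hy1 m k]; exact add_sub_cancel_left _ _
  have hleft (k : ℤ) : ∑' m : ℤ, (latticePoint τ x y m k ^ 2)⁻¹ =
      ∑' m : ℤ, (latticePoint τ x y m k ^ 2 * latticePoint τ x y (m + 1) k)⁻¹ := by
    have htel := tsum_int_sub_succ (l := 0) (l' := 0) (hdiffl k)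
      ((tendsto_inv_add_nat (x + (y + k) * τ)).congr fun n => by
        simp only [latticePoint]; push_cast; ring_nf)
      (by
        have := (tendsto_inv_add_nat (-(x + (y + k) * τ))).neg
        rw [neg_zero] at this
        refine this.congr fun n => ?_
        rw [← inv_neg]
        simp only [latticePoint]; push_cast; ring_nf)
    simp_rw [inv_latticePoint_sq hτ hy0 hy1 _ k]
    rw [(hSl k).tsum_add (hdiffl k), htel]
    simp
  set u : ℤ → ℂ := fun m => (x + m) / τ + y with hu
  have hu_mem (m : ℤ) : u m ∈ Complex.integerComplement :=
    add_div_add_mem_integerComplement hτ hx0 hx1 m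
  have hinv (m k : ℤ) : (latticePoint τ x y m k)⁻¹ = τ⁻¹ * (u m + k)⁻¹ := by
    rw [latticePoint_eq_mul hτ0, mul_inv]
  have hright (m : ℤ) : ∑' k : ℤ, (latticePoint τ x y m k ^ 2)⁻¹ =
      ∑' k : ℤ, (latticePoint τ x y m k ^ 2 * latticePoint τ x y (m + 1) k)⁻¹
        + (π / τ * cot (π * u m) - π / τ * cot (π * u (m + 1))) := by
    have hs : Summable fun k : ℤ => (u m + k)⁻¹ - (u (m + 1) + k)⁻¹ := by
      refine ((hdiffr m).mul_left τ).congr fun k => ?_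
      rw [hinv, hinv]; field_simp
    have hcot := tsum_inv_sub_inv_eq_cot (hu_mem m) (hu_mem (m + 1)) hs
    simp_rw [inv_latticePoint_sq hτ hy0 hy1 m]
    rw [(hSr m).tsum_add (hdiffr m)]
    congr 1
    simp_rw [hinv, ← mul_sub]
    rw [tsum_mul_left, hcot]
    ring
  have hcots : Summable fun m : ℤ => π / τ * cot (π * u m) - π / τ * cot (π * u (m + 1)) :=
    (hsum.sub hSp).congr fun m => by rw [hright]; exact add_sub_cancel_left _ _
  have him := im_neg_one_div_pos hτ
  have htel := tsum_int_sub_succ (l := π / τ * I) (l' := π / τ * (-I)) hcots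
    (by
      refine Tendsto.const_mul _ ?_
      have := (tendsto_cot_pi_add_nat_mul (-(x / τ + y)) him).neg
      rw [neg_neg] at this
      refine this.congr fun n => ?_
      rw [← complex_cot_neg]
      congr 1
      simp only [hu]; push_cast; ring)
    (by
      refine Tendsto.const_mul _ ?_
      refine (tendsto_cot_pi_add_nat_mul (x / τ + y) him).congr fun n => ?_
      congr 1
      simp only [hu]; push_cast; ring)
  simp_rw [hleft, hright]
  rw [hSp.tsum_add hcots, htel, Summable.tsum_comm (f := fun m k : ℤ =>
    (latticePoint τ x y m k ^ 2 * latticePoint τ x y (m + 1) k)⁻¹) hS]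
  ring

end

lemma summable_succ_mul_norm_pow {P : ℂ} (hP : ‖P‖ < 1) :
    Summable fun n : ℕ => ((n : ℝ) + 1) * ‖P‖ ^ (n + 1) := by
  have := (summable_nat_add_iff 1).2
    (summable_pow_mul_geometric_of_norm_lt_one 1 (r := ‖P‖) (by simpa using hP))
  simpa using this

lemma hasSum_tsum_succ_mul_pow {P Q : ℂ} (hP : ‖P‖ < 1) (hQ : ‖Q‖ < 1) :
    HasSum (fun k : ℕ => ∑' n : ℕ, ((n : ℂ) + 1) * (P * Q ^ k) ^ (n + 1))
      (∑' n : ℕ, ((n : ℂ) + 1) * P ^ (n + 1) / (1 - Q ^ (n + 1))) := by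
  have hA := summable_succ_mul_norm_pow hP
  have hB : Summable fun k : ℕ => ‖Q‖ ^ k := summable_geometric_of_lt_one (norm_nonneg _) hQ
  have hS : Summable fun p : ℕ × ℕ => ((p.1 : ℂ) + 1) * (P * Q ^ p.2) ^ (p.1 + 1) := by
    refine Summable.of_norm_bounded
      (hA.mul_of_nonneg hB (fun _ => by positivity) (fun _ => by positivity)) fun p => ?_
    have h1 : ‖(p.1 : ℂ) + 1‖ = (p.1 : ℝ) + 1 := by
      exact_mod_cast Complex.norm_natCast (p.1 + 1)
    have h2 : (‖Q‖ ^ p.2) ^ (p.1 + 1) ≤ ‖Q‖ ^ p.2 :=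
      pow_le_of_le_one (by positivity) (pow_le_one₀ (norm_nonneg _) hQ.le) (Nat.succ_ne_zero _)
    rw [norm_mul, norm_pow, norm_mul, norm_pow, mul_pow, h1, ← mul_assoc]
    gcongr
  have hgeom (n : ℕ) : ∑' k : ℕ, ((n : ℂ) + 1) * (P * Q ^ k) ^ (n + 1) =
      ((n : ℂ) + 1) * P ^ (n + 1) / (1 - Q ^ (n + 1)) := by
    have hQn : ‖Q ^ (n + 1)‖ < 1 := by
      rw [norm_pow]; exact pow_lt_one₀ (norm_nonneg _) hQ (Nat.succ_ne_zero _)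
    rw [div_eq_mul_inv, ← tsum_geometric_of_norm_lt_one hQn, ← tsum_mul_left]
    refine tsum_congr fun k => ?_
    rw [mul_pow, ← pow_mul, ← pow_mul, mul_comm k]
    ring
  have h := hS.prod_symm.prod.hasSum
  simp only [Prod.swap_prod_mk] at h
  have h2 : ∑' k : ℕ, ∑' n : ℕ, ((n : ℂ) + 1) * (P * Q ^ k) ^ (n + 1)
      = ∑' n : ℕ, ∑' k : ℕ, ((n : ℂ) + 1) * (P * Q ^ k) ^ (n + 1) :=
    Summable.tsum_comm (f := fun n k : ℕ => ((n : ℂ) + 1) * (P * Q ^ k) ^ (n + 1)) hS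
  rw [h2] at h
  simpa only [hgeom] using h

lemma summable_succ_mul_pow_div {P Q : ℂ} (hP : ‖P‖ < 1) (hQ : ‖Q‖ < 1) :
    Summable fun n : ℕ => ((n : ℂ) + 1) * P ^ (n + 1) / (1 - Q ^ (n + 1)) := by
  have hA := summable_succ_mul_norm_pow hP
  refine Summable.of_norm_bounded (hA.mul_right (1 - ‖Q‖)⁻¹) fun n => ?_
  have h1 : ‖(n : ℂ) + 1‖ = (n : ℝ) + 1 := by
    exact_mod_cast Complex.norm_natCast (n + 1)
  have h2 : 1 - ‖Q‖ ≤ ‖1 - Q ^ (n + 1)‖ := by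
    have h3 := norm_sub_norm_le (1 : ℂ) (Q ^ (n + 1))
    rw [norm_one, norm_pow] at h3
    have h4 : ‖Q‖ ^ (n + 1) ≤ ‖Q‖ := pow_le_of_le_one (norm_nonneg _) hQ.le (Nat.succ_ne_zero _)
    linarith
  have h5 : 0 < 1 - ‖Q‖ := by linarith
  rw [norm_div, norm_mul, norm_pow, h1, div_eq_mul_inv]
  gcongr

lemma tsum_inv_add_int_sq {u : ℂ} (hu : 0 < u.im) :
    ∑' m : ℤ, ((u + m) ^ 2)⁻¹ =
      -4 * π ^ 2 * ∑' n : ℕ, ((n : ℂ) + 1) * cexp (2 * π * I * u) ^ (n + 1) := by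
  have h := EisensteinSeries.qExpansion_identity_pnat (k := 1) le_rfl ⟨u, hu⟩
  simp only [one_div, Nat.reduceAdd, pow_one, Nat.factorial_one,
    Nat.cast_one, div_one] at h
  rw [h, tsum_pnat_eq_tsum_succ (f := fun n : ℕ => (n : ℂ) * cexp (2 * π * I * u) ^ n)]
  push_cast
  rw [mul_pow, mul_pow, I_sq]
  ring

lemma hasSum_tsum_inv_latticePoint_sq {τ : ℂ} (hτ : 0 < τ.im) {x y : ℝ} (hy0 : 0 < y)
    (hy1 : y < 1) :
    HasSum (fun k : ℤ => ∑' m : ℤ, (latticePoint τ x y m k ^ 2)⁻¹)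
      (-4 * π ^ 2 * ∑' n : ℕ, ((n : ℂ) + 1) *
        (cexp (2 * π * I * (x + y * τ)) ^ (n + 1)
          + cexp (2 * π * I * (-x + (1 - y) * τ)) ^ (n + 1)) /
            (1 - cexp (2 * π * I * τ) ^ (n + 1))) := by
  have hQ : ‖cexp (2 * π * I * τ)‖ < 1 := UpperHalfPlane.norm_exp_two_pi_I_lt_one ⟨τ, hτ⟩
  have im1 : 0 < ((x : ℂ) + y * τ).im := by simpa using mul_pos hy0 hτ
  have im2 : 0 < (-(x : ℂ) + (1 - y) * τ).im := by simpa using mul_pos (sub_pos.2 hy1) hτ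
  have hP : ‖cexp (2 * π * I * (x + y * τ))‖ < 1 :=
    UpperHalfPlane.norm_exp_two_pi_I_lt_one ⟨_, im1⟩
  have hP' : ‖cexp (2 * π * I * (-x + (1 - y) * τ))‖ < 1 :=
    UpperHalfPlane.norm_exp_two_pi_I_lt_one ⟨_, im2⟩
  have him (k : ℕ) : 0 ≤ ((k : ℂ) * τ).im := by simpa using mul_nonneg k.cast_nonneg hτ.le
  have hexp (v : ℂ) (k : ℕ) : cexp (2 * π * I * (v + k * τ))
      = cexp (2 * π * I * v) * cexp (2 * π * I * τ) ^ k := by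
    rw [← Complex.exp_nat_mul, ← Complex.exp_add]; ring_nf
  have h1 := (hasSum_tsum_succ_mul_pow hP hQ).mul_left (-4 * (π : ℂ) ^ 2)
  have h2 := (hasSum_tsum_succ_mul_pow hP' hQ).mul_left (-4 * (π : ℂ) ^ 2)
  have h3 : (fun k : ℕ => ∑' m : ℤ, (latticePoint τ x y m (k : ℤ) ^ 2)⁻¹) = fun k : ℕ =>
      -4 * (π : ℂ) ^ 2 * ∑' n : ℕ, ((n : ℂ) + 1) *
        (cexp (2 * π * I * (x + y * τ)) * cexp (2 * π * I * τ) ^ k) ^ (n + 1) := by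
    funext k
    rw [← hexp, ← tsum_inv_add_int_sq (by rw [add_im]; exact add_pos_of_pos_of_nonneg im1 (him k))]
    refine tsum_congr fun m => ?_
    simp only [latticePoint]; push_cast; ring_nf
  have h4 : (fun k : ℕ => ∑' m : ℤ, (latticePoint τ x y m (-(k + 1) : ℤ) ^ 2)⁻¹) = fun k : ℕ =>
      -4 * (π : ℂ) ^ 2 * ∑' n : ℕ, ((n : ℂ) + 1) *
        (cexp (2 * π * I * (-x + (1 - y) * τ)) * cexp (2 * π * I * τ) ^ k) ^ (n + 1) := by
    funext k
    rw [← hexp, ← tsum_inv_add_int_sq (by rw [add_im]; exact add_pos_of_pos_of_nonneg im2 (him k)),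
      ← (Equiv.neg ℤ).tsum_eq]
    refine tsum_congr fun m => ?_
    rw [← neg_sq]
    simp only [latticePoint, Equiv.neg_apply]; push_cast; ring_nf
  rw [← h3] at h1
  rw [← h4] at h2
  have h5 := HasSum.of_nat_of_neg_add_one
    (f := fun k : ℤ => ∑' m : ℤ, (latticePoint τ x y m k ^ 2)⁻¹) h1 h2
  rw [← mul_add, ← (summable_succ_mul_pow_div hP hQ).tsum_add
    (summable_succ_mul_pow_div hP' hQ)] at h5
  simpa only [mul_add, add_div] using h5

lemma exp_add_exp_div_eq {τ z : ℂ} (hτ : 0 < τ.im) (N : ℕ) (hN : N ≠ 0) :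
    (cexp (2 * π * I * (1 / 2 + z + τ / 2)) ^ N + cexp (2 * π * I * (-(1 / 2) - z + τ / 2)) ^ N) /
        (1 - cexp (2 * π * I * τ) ^ N) =
      I * ((-1) ^ N * cos (2 * N * π * z) / sin (N * π * τ)) := by
  have hpi : cexp (π * I) ^ N = (-1) ^ N := by rw [exp_pi_mul_I]
  have hpi' : cexp (-(π * I)) ^ N = (-1) ^ N := by rw [exp_neg, exp_pi_mul_I]; norm_num
  have hq : cexp (2 * π * I * τ) ^ N ≠ 1 := by
    intro h
    have h1 : ‖cexp (2 * π * I * τ)‖ < 1 := UpperHalfPlane.norm_exp_two_pi_I_lt_one ⟨τ, hτ⟩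
    have h2 := pow_lt_one₀ (norm_nonneg _) h1 hN
    rw [← norm_pow, h, norm_one] at h2
    exact lt_irrefl _ h2
  have e1 : cexp (2 * π * I * (1 / 2 + z + τ / 2)) ^ N
      = (-1) ^ N * cexp (2 * N * π * z * I) * cexp (N * π * τ * I) := by
    rw [← hpi, ← exp_nat_mul, ← exp_nat_mul, ← exp_add, ← exp_add]; ring_nf
  have e2 : cexp (2 * π * I * (-(1 / 2) - z + τ / 2)) ^ N
      = (-1) ^ N * cexp (-(2 * N * π * z) * I) * cexp (N * π * τ * I) := by
    rw [← hpi', ← exp_nat_mul, ← exp_nat_mul, ← exp_add, ← exp_add]; ring_nf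
  have e3 : cexp (2 * π * I * τ) ^ N = cexp (N * π * τ * I) ^ 2 := by
    rw [← exp_nat_mul, ← exp_nat_mul]; push_cast; ring_nf
  have e4 : cexp (-(N * π * τ) * I) = (cexp (N * π * τ * I))⁻¹ := by
    rw [neg_mul, exp_neg]
  rw [e3] at hq
  have h0 := exp_ne_zero (N * π * τ * I)
  rw [e1, e2, e3, Complex.cos, Complex.sin, e4]
  generalize cexp (N * π * τ * I) = E at *
  have hq1 : 1 - E ^ 2 ≠ 0 := sub_ne_zero.2 (Ne.symm hq)
  have hs : (E⁻¹ - E) * I / 2 = (1 - E ^ 2) * I / (2 * E) := by field_simp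
  rw [hs]
  field_simp

lemma hasSum_tsum_inv_latticePoint_sq_half {τ : ℂ} (hτ : 0 < τ.im) (α : ℝ) {β : ℝ}
    (hβ : |β| < 1 / 2) :
    HasSum (fun k : ℤ => ∑' m : ℤ, (latticePoint τ (α + 1 / 2) (β + 1 / 2) m k ^ 2)⁻¹)
      (-4 * π ^ 2 * I * ∑' n : ℕ, (-1 : ℂ) ^ (n + 1) * ((n : ℂ) + 1) *
        cos (2 * ((n : ℂ) + 1) * π * ((α : ℂ) + (β : ℂ) * τ)) / sin (((n : ℂ) + 1) * π * τ)) := by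
  rw [abs_lt] at hβ
  have h := hasSum_tsum_inv_latticePoint_sq hτ (x := α + 1 / 2) (y := β + 1 / 2)
    (by linarith) (by linarith)
  convert! h using 1
  rw [mul_assoc, ← tsum_mul_left]
  congr 1
  refine tsum_congr fun n => ?_
  have key := exp_add_exp_div_eq hτ (z := α + β * τ) (n + 1) n.succ_ne_zero
  have a1 : ((α + 1 / 2 : ℝ) : ℂ) + ((β + 1 / 2 : ℝ) : ℂ) * τ
      = 1 / 2 + (α + β * τ) + τ / 2 := by push_cast; ring
  have a2 : -((α + 1 / 2 : ℝ) : ℂ) + (1 - ((β + 1 / 2 : ℝ) : ℂ)) * τ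
      = -(1 / 2) - (α + β * τ) + τ / 2 := by push_cast; ring
  rw [a1, a2, mul_div_assoc (_ + 1) (_ + _), key]
  push_cast
  ring

theorem stmt8 (τ : ℂ) (hτ : 0 < τ.im) (α β : ℝ) (hα : |α| < 1/2) (hβ : |β| < 1/2) :
    (1 / (2 * (π : ℂ)))
      + τ * ∑' n : ℕ, (-1 : ℂ) ^ (n + 1) * ((n : ℂ) + 1) *
          Complex.cos (2 * ((n : ℂ) + 1) * π * ((α : ℂ) + (β : ℂ) * τ)) /
          Complex.sin (((n : ℂ) + 1) * π * τ)
      + (1 / τ) * ∑' n : ℕ, (-1 : ℂ) ^ (n + 1) * ((n : ℂ) + 1) *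
          Complex.cos (2 * ((n : ℂ) + 1) * π * ((α : ℂ) + (β : ℂ) * τ) / τ) /
          Complex.sin (((n : ℂ) + 1) * π / τ) = 0 := by
  have hτ0 : τ ≠ 0 := fun h => by simp [h] at hτ
  have hπ : (π : ℂ) ≠ 0 := ofReal_ne_zero.2 Real.pi_ne_zero
  have him := im_neg_one_div_pos hτ
  have h1 := (hasSum_tsum_inv_latticePoint_sq_half hτ α hβ).tsum_eq
  have h2 := hasSum_tsum_inv_latticePoint_sq_half him β (β := -α) (by rwa [abs_neg])
  have hg : ∑' n : ℕ, (-1 : ℂ) ^ (n + 1) * ((n : ℂ) + 1) *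
        cos (2 * ((n : ℂ) + 1) * π * ((β : ℂ) + ((-α : ℝ) : ℂ) * (-1 / τ))) /
          sin (((n : ℂ) + 1) * π * (-1 / τ))
      = -∑' n : ℕ, (-1 : ℂ) ^ (n + 1) * ((n : ℂ) + 1) *
        cos (2 * ((n : ℂ) + 1) * π * ((α : ℂ) + (β : ℂ) * τ) / τ) /
          sin (((n : ℂ) + 1) * π / τ) := by
    rw [← tsum_neg]
    refine tsum_congr fun n => ?_
    have e1 : 2 * ((n : ℂ) + 1) * π * ((β : ℂ) + ((-α : ℝ) : ℂ) * (-1 / τ))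
        = 2 * ((n : ℂ) + 1) * π * ((α : ℂ) + (β : ℂ) * τ) / τ := by
      push_cast; field_simp; ring
    have e2 : ((n : ℂ) + 1) * π * (-1 / τ) = -(((n : ℂ) + 1) * π / τ) := by ring
    rw [e1, e2, Complex.sin_neg, div_neg]
  rw [hg] at h2
  have h3 := (Equiv.subLeft (-1 : ℤ)).hasSum_iff.2 h2
  have h4 : ((fun k : ℤ => ∑' m : ℤ,
      (latticePoint (-1 / τ) (β + 1 / 2) (-α + 1 / 2) m k ^ 2)⁻¹) ∘ (Equiv.subLeft (-1 : ℤ)))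
      = fun m : ℤ => τ ^ 2 * ∑' k : ℤ, (latticePoint τ (α + 1 / 2) (β + 1 / 2) m k ^ 2)⁻¹ := by
    funext m
    simp only [Function.comp_apply, Equiv.subLeft_apply]
    rw [← tsum_mul_left]
    refine tsum_congr fun k => ?_
    have e : latticePoint (-1 / τ) (β + 1 / 2) (-α + 1 / 2) k (-1 - m)
        = latticePoint τ (α + 1 / 2) (β + 1 / 2) m k / τ := by
      simp only [latticePoint]; push_cast; field_simp; ring
    rw [e, div_pow, inv_div, div_eq_mul_inv]
  rw [h4] at h3
  have hsum : Summable fun m : ℤ =>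
      ∑' k : ℤ, (latticePoint τ (α + 1 / 2) (β + 1 / 2) m k ^ 2)⁻¹ :=
    (summable_mul_left_iff (pow_ne_zero 2 hτ0)).1 h3.summable
  have h5 := h3.tsum_eq
  rw [tsum_mul_left] at h5
  rw [abs_lt] at hα hβ
  have h6 := tsum_tsum_inv_latticePoint_sq hτ (x := α + 1 / 2) (y := β + 1 / 2) (by linarith)
    (by linarith) (by linarith) (by linarith) hsum
  rw [h1] at h6
  generalize (∑' m : ℤ, ∑' k : ℤ, (latticePoint τ (α + 1 / 2) (β + 1 / 2) m k ^ 2)⁻¹) = S at *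
  generalize (∑' n : ℕ, (-1 : ℂ) ^ (n + 1) * ((n : ℂ) + 1) *
    cos (2 * ((n : ℂ) + 1) * π * ((α : ℂ) + (β : ℂ) * τ)) / sin (((n : ℂ) + 1) * π * τ)) = F at *
  generalize (∑' n : ℕ, (-1 : ℂ) ^ (n + 1) * ((n : ℂ) + 1) *
    cos (2 * ((n : ℂ) + 1) * π * ((α : ℂ) + (β : ℂ) * τ) / τ) / sin (((n : ℂ) + 1) * π / τ)) = G
    at *
  field_simp at h6
  have hI := I_ne_zero
  have h7 : (4 * π ^ 2 * I) * (τ + τ ^ 2 * 2 * π * F + 2 * π * G) = 0 := by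
    linear_combination (-2 * π * τ) * h6 - 2 * π * h5
  have h8 := (mul_eq_zero.1 h7).resolve_left (by simp [hπ, hI])
  field_simp
  linear_combination h8
end
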